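/- Let β > 0 and let b ≥ 2 be an integer; set N = b². Define f₀ : 𝕋 → ℝ by f₀(z) = exp(β · Re z) (i.e. f₀(e^{iθ}) = exp(β cos θ)), and recursively f_{k+1} = T f_k, where T is the Migdal–Kadanoff transformation on the circle group. For k ∈ ℕ and n ∈ ℤ define the normalized Fourier coefficients c_n(k) = (∫_𝕋 f_k(z) z^{−n} dμ(z)) / (∫_𝕋 f_k(z) dμ(z)). Then for every n ≠ 0, c_n(k) → 0 as k → ∞. -/

import Mathlib

open MeasureTheory Filter

noncomputable section

instance : MeasurableSpace Circle := borel Circle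
instance : BorelSpace Circle := ⟨rfl⟩

/-- The extension of a family `w : Fin (N-1) → 𝕋` of integration variables to the sequence
`w₀ = 1, w₁, …, w_{N-1}, w_N = z`. -/
def mkExt (N : ℕ) (z : Circle) (w : Fin (N - 1) → Circle) : ℕ → Circle := fun i =>
  if h : 0 < i ∧ i < N then w ⟨i - 1, by omega⟩ else if i = 0 then 1 else z

/-- The Migdal–Kadanoff transformation on the circle group (dimension `D = 4`, scale
factor `b`, `N = b²`):
`(T f)(z) = ∫_{𝕋^{N−1}} ∏_{k=1}^{N} f(w_{k−1}⁻¹ w_k)^{N} dμ(w₁)⋯dμ(w_{N−1})`,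
with `w₀ = 1` and `w_N = z`. -/
def MK (μ : Measure Circle) (N : ℕ) (f : Circle → ℝ) : Circle → ℝ := fun z =>
  ∫ w : Fin (N - 1) → Circle,
    ∏ k ∈ Finset.range N, f ((mkExt N z w k)⁻¹ * mkExt N z w (k + 1)) ^ N
    ∂(Measure.pi fun _ => μ)

/-- The quadratic lower bound `-a t²` on the second differences of `log f`, i.e. convexity of
`θ ↦ log f(e^{iθ}) + a θ² / 2`. -/
def LogSemiconvex (a : ℝ) (f : Circle → ℝ) : Prop :=
  ∀ (z : Circle) (t : ℝ), 2 * Real.log (f z) - a * t ^ 2 ≤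
    Real.log (f (z * Circle.exp t)) + Real.log (f (z * Circle.exp (-t)))

theorem Continuous.integrable_of_compactSpace {X : Type*} [TopologicalSpace X] [CompactSpace X]
    [MeasurableSpace X] [OpensMeasurableSpace X] {ν : Measure X} [IsFiniteMeasure ν]
    {E : Type*} [NormedAddCommGroup E] [SecondCountableTopologyEither X E]
    {f : X → E} (hf : Continuous f) : Integrable f ν :=
  hf.integrable_of_hasCompactSupport (HasCompactSupport.of_compactSpace f)

/-- The Gibbs inequality. -/
theorem integral_mul_log_sub_log_le {X : Type*} [MeasurableSpace X] {ν : Measure X}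
    {P Q : X → ℝ} (hP : ∀ x, 0 < P x) (hQ : ∀ x, 0 < Q x)
    (hPi : Integrable P ν) (hQi : Integrable Q ν)
    (hL : Integrable (fun x => P x * (Real.log (Q x) - Real.log (P x))) ν)
    (hP0 : 0 < ∫ x, P x ∂ν) (hQ0 : 0 < ∫ x, Q x ∂ν) :
    ∫ x, P x * (Real.log (Q x) - Real.log (P x)) ∂ν ≤
      (∫ x, P x ∂ν) * (Real.log (∫ x, Q x ∂ν) - Real.log (∫ x, P x ∂ν)) := by
  set p := ∫ x, P x ∂ν with hp
  set q := ∫ x, Q x ∂ν with hq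
  have key : ∀ x, P x * (Real.log (Q x) - Real.log (P x)) ≤
      P x * (Real.log q - Real.log p - 1) + Q x * (p / q) := by
    intro x
    have h := Real.log_le_sub_one_of_pos (x := Q x * p / (P x * q))
      (div_pos (mul_pos (hQ x) hP0) (mul_pos (hP x) hQ0))
    rw [Real.log_div (mul_pos (hQ x) hP0).ne' (mul_pos (hP x) hQ0).ne',
      Real.log_mul (hQ x).ne' hP0.ne', Real.log_mul (hP x).ne' hQ0.ne'] at h
    have h2 := mul_le_mul_of_nonneg_left h (hP x).le
    have h3 : P x * (Q x * p / (P x * q) - 1) = Q x * (p / q) - P x := by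
      have := (hP x).ne'
      field_simp
    rw [h3] at h2
    linarith
  calc _ ≤ ∫ x, (P x * (Real.log q - Real.log p - 1) + Q x * (p / q)) ∂ν :=
        integral_mono hL ((hPi.mul_const _).add (hQi.mul_const _)) key
    _ = p * (Real.log q - Real.log p - 1) + q * (p / q) := by
        rw [integral_add (hPi.mul_const _) (hQi.mul_const _), integral_mul_const,
          integral_mul_const]
    _ = _ := by
        field_simp
        ring

/-- The integrand of the Migdal–Kadanoff transformation. -/
def mkWeight (N : ℕ) (f : Circle → ℝ) (z : Circle) (w : Fin (N - 1) → Circle) : ℝ :=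
  ∏ k ∈ Finset.range N, f ((mkExt N z w k)⁻¹ * mkExt N z w (k + 1)) ^ N

theorem continuous_mkExt (N i : ℕ) :
    Continuous fun p : Circle × (Fin (N - 1) → Circle) => mkExt N p.1 p.2 i := by
  unfold mkExt
  split_ifs
  · fun_prop
  · fun_prop
  · fun_prop

theorem continuous_mkWeight {N : ℕ} {f : Circle → ℝ} (hf : Continuous f) :
    Continuous fun p : Circle × (Fin (N - 1) → Circle) => mkWeight N f p.1 p.2 := by
  unfold mkWeight
  refine continuous_finsetProd _ fun k _ => (hf.comp ?_).pow N
  exact (continuous_mkExt N k).inv.mul (continuous_mkExt N (k + 1))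

theorem continuous_mkWeight_right {N : ℕ} {f : Circle → ℝ} (hf : Continuous f) (z : Circle) :
    Continuous (mkWeight N f z) :=
  Continuous.comp (g := fun p : Circle × (Fin (N - 1) → Circle) => mkWeight N f p.1 p.2)
    (f := fun w => (z, w)) (continuous_mkWeight hf) (Continuous.prodMk_right z)

theorem mkWeight_pos {N : ℕ} {f : Circle → ℝ} (hpos : ∀ z, 0 < f z) (z : Circle)
    (w : Fin (N - 1) → Circle) : 0 < mkWeight N f z w :=
  Finset.prod_pos fun _ _ => pow_pos (hpos _) _

theorem mkWeight_le {N : ℕ} {f : Circle → ℝ} {M : ℝ} (hpos : ∀ z, 0 < f z) (hM : ∀ z, f z ≤ M)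
    (z : Circle) (w : Fin (N - 1) → Circle) : mkWeight N f z w ≤ M ^ (N ^ 2) := by
  calc mkWeight N f z w ≤ ∏ _k ∈ Finset.range N, M ^ N :=
        Finset.prod_le_prod (fun _ _ => (pow_pos (hpos _) _).le)
          fun _ _ => pow_le_pow_left₀ (hpos _).le (hM _) _
    _ = M ^ (N ^ 2) := by
        rw [Finset.prod_const, Finset.card_range, ← pow_mul, sq]

theorem le_mkWeight {N : ℕ} {f : Circle → ℝ} {m : ℝ} (hm0 : 0 ≤ m) (hm : ∀ z, m ≤ f z)
    (z : Circle) (w : Fin (N - 1) → Circle) : m ^ (N ^ 2) ≤ mkWeight N f z w := by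
  calc m ^ (N ^ 2) = ∏ _k ∈ Finset.range N, m ^ N := by
        rw [Finset.prod_const, Finset.card_range, ← pow_mul, sq]
    _ ≤ mkWeight N f z w :=
        Finset.prod_le_prod (fun _ _ => pow_nonneg hm0 _)
          fun _ _ => pow_le_pow_left₀ hm0 (hm _) _

theorem log_mkWeight {N : ℕ} {f : Circle → ℝ} (hpos : ∀ z, 0 < f z) (z : Circle)
    (w : Fin (N - 1) → Circle) : Real.log (mkWeight N f z w) =
      ∑ k ∈ Finset.range N, N * Real.log (f ((mkExt N z w k)⁻¹ * mkExt N z w (k + 1))) := by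
  unfold mkWeight
  rw [Real.log_prod fun _ _ => (pow_pos (hpos _) _).ne']
  simp_rw [Real.log_pow]

theorem mkExt_shift {N : ℕ} (z : Circle) (w : Fin (N - 1) → Circle) (s : ℝ) {i : ℕ} (hi : i ≤ N) :
    mkExt N (z * Circle.exp (N * s))
      ((fun j : Fin (N - 1) => Circle.exp (((j : ℕ) + 1 : ℕ) * s)) * w) i =
      mkExt N z w i * Circle.exp (i * s) := by
  unfold mkExt
  split_ifs with h h'
  · have : i - 1 + 1 = i := by omega
    simp only [Pi.mul_apply, this]
    rw [mul_comm]
  · simp [h']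
  · have : i = N := by omega
    rw [this]

theorem mkWeight_shift {N : ℕ} (f : Circle → ℝ) (z : Circle) (w : Fin (N - 1) → Circle) (s : ℝ) :
    mkWeight N f (z * Circle.exp (N * s))
        ((fun j : Fin (N - 1) => Circle.exp (((j : ℕ) + 1 : ℕ) * s)) * w) =
      mkWeight N (fun y => f (y * Circle.exp s)) z w := by
  unfold mkWeight
  refine Finset.prod_congr rfl fun k hk => ?_
  have hk := Finset.mem_range.1 hk
  rw [mkExt_shift z w s hk.le, mkExt_shift z w s (Nat.succ_le_of_lt hk)]
  have : Circle.exp (((k + 1 : ℕ) : ℝ) * s) = Circle.exp (k * s) * Circle.exp s := by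
    rw [← Circle.exp_add]
    push_cast
    ring_nf
  rw [this]
  congr 2
  rw [mul_inv]
  calc _ = (mkExt N z w k)⁻¹ * mkExt N z w (k + 1) *
        ((Circle.exp (k * s))⁻¹ * Circle.exp (k * s)) * Circle.exp s := by
        simp only [mul_assoc, mul_left_comm]
    _ = _ := by rw [inv_mul_cancel, mul_one]

/-- The second difference of `log f` with step `s`, plus `a s²`. -/
def logSecondDiff (f : Circle → ℝ) (a s : ℝ) (y : Circle) : ℝ :=
  Real.log (f (y * Circle.exp s)) + Real.log (f (y * Circle.exp (-s))) - 2 * Real.log (f y) +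
    a * s ^ 2

theorem LogSemiconvex.logSecondDiff_nonneg {f : Circle → ℝ} {a : ℝ} (h : LogSemiconvex a f)
    (s : ℝ) (y : Circle) : 0 ≤ logSecondDiff f a s y := by
  have := h y s
  unfold logSecondDiff
  linarith

theorem continuous_logSecondDiff {f : Circle → ℝ} (hf : Continuous f) (hpos : ∀ z, 0 < f z)
    (a s : ℝ) : Continuous (logSecondDiff f a s) := by
  have hlogc : Continuous fun y => Real.log (f y) := hf.log fun y => (hpos y).ne'
  unfold logSecondDiff
  exact (((hlogc.comp (continuous_mul_const (Circle.exp s))).add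
    (hlogc.comp (continuous_mul_const (Circle.exp (-s))))).sub
    (continuous_const.mul hlogc)).add continuous_const

theorem le_log_mkWeight_shift {N : ℕ} (hN : 2 ≤ N) {f : Circle → ℝ} (hpos : ∀ z, 0 < f z)
    {a : ℝ} (h : LogSemiconvex a f) (s : ℝ) (z : Circle) (w : Fin (N - 1) → Circle) :
    N * logSecondDiff f a s (w ⟨0, by omega⟩) - a * (N * s) ^ 2 ≤
      (Real.log (mkWeight N (fun y => f (y * Circle.exp s)) z w) -
        Real.log (mkWeight N f z w)) +
      (Real.log (mkWeight N (fun y => f (y * Circle.exp (-s))) z w) -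
        Real.log (mkWeight N f z w)) := by
  have hlog : (Real.log (mkWeight N (fun y => f (y * Circle.exp s)) z w) -
        Real.log (mkWeight N f z w)) +
      (Real.log (mkWeight N (fun y => f (y * Circle.exp (-s))) z w) -
        Real.log (mkWeight N f z w)) = ∑ k ∈ Finset.range N,
        (N * logSecondDiff f a s ((mkExt N z w k)⁻¹ * mkExt N z w (k + 1)) -
          N * (a * s ^ 2)) := by
    rw [log_mkWeight hpos, log_mkWeight (f := fun y => f (y * Circle.exp s)) (fun y => hpos _),
      log_mkWeight (f := fun y => f (y * Circle.exp (-s))) (fun y => hpos _),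
      ← Finset.sum_sub_distrib, ← Finset.sum_sub_distrib, ← Finset.sum_add_distrib]
    refine Finset.sum_congr rfl fun k _ => ?_
    unfold logSecondDiff
    ring
  have h0 : (mkExt N z w 0)⁻¹ * mkExt N z w (0 + 1) = w ⟨0, by omega⟩ := by
    have : 1 < N := by omega
    simp [mkExt, this]
  have hle := Finset.single_le_sum
    (f := fun k => N * logSecondDiff f a s ((mkExt N z w k)⁻¹ * mkExt N z w (k + 1)))
    (fun k _ => mul_nonneg (Nat.cast_nonneg N) (h.logSecondDiff_nonneg s _))
    (Finset.mem_range.2 (by omega : 0 < N))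
  simp only [h0] at hle
  rw [hlog, Finset.sum_sub_distrib, Finset.sum_const, Finset.card_range, nsmul_eq_mul]
  linarith

section Transformation

variable {μ : Measure Circle}

theorem MK_mul_exp [μ.IsHaarMeasure] (N : ℕ) (f : Circle → ℝ) (z : Circle) (s : ℝ) :
    MK μ N f (z * Circle.exp (N * s)) =
      MK μ N (fun y => f (y * Circle.exp s)) z := by
  have h := integral_mul_left_eq_self (μ := Measure.pi fun _ : Fin (N - 1) => μ)
    (mkWeight N f (z * Circle.exp (N * s)))
    (fun j : Fin (N - 1) => Circle.exp (((j : ℕ) + 1 : ℕ) * s))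
  simp only [mkWeight_shift] at h
  exact h.symm

theorem integrable_mkWeight [IsFiniteMeasure μ] {N : ℕ} {f : Circle → ℝ} (hf : Continuous f)
    (z : Circle) :
    Integrable (mkWeight N f z) (Measure.pi fun _ => μ) :=
  (continuous_mkWeight_right hf z).integrable_of_compactSpace

theorem integral_mkWeight_pos [μ.IsHaarMeasure] [IsProbabilityMeasure μ] {N : ℕ}
    {f : Circle → ℝ} (hf : Continuous f) (hpos : ∀ z, 0 < f z)
    (z : Circle) : 0 < ∫ w, mkWeight N f z w ∂(Measure.pi fun _ => μ) := by
  rw [integral_pos_iff_support_of_nonneg (fun w => (mkWeight_pos hpos z w).le)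
    (integrable_mkWeight hf z)]
  have : Function.support (mkWeight N f z) = Set.univ :=
    Set.eq_univ_of_forall fun w => (mkWeight_pos hpos z w).ne'
  rw [this]
  simp

theorem MK_pos [μ.IsHaarMeasure] [IsProbabilityMeasure μ] {N : ℕ} {f : Circle → ℝ}
    (hf : Continuous f) (hpos : ∀ z, 0 < f z) (z : Circle) :
    0 < MK μ N f z :=
  integral_mkWeight_pos hf hpos z

theorem continuous_MK [IsFiniteMeasure μ] {N : ℕ} {f : Circle → ℝ}
    (hf : Continuous f) : Continuous (MK μ N f) := by
  have := continuous_parametric_integral_of_continuous (μ := Measure.pi fun _ : Fin (N - 1) => μ)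
    (f := mkWeight N f) (continuous_mkWeight hf) isCompact_univ
  rw [Measure.restrict_univ] at this
  exact this

/-- The mean of the second difference of a function with respect to Haar measure vanishes. -/
theorem integral_second_difference [μ.IsHaarMeasure] [IsProbabilityMeasure μ] {g : Circle → ℝ}
    (hg : Continuous g) (s c : ℝ) :
    ∫ y, (g (y * Circle.exp s) + g (y * Circle.exp (-s)) - 2 * g y + c) ∂μ = c := by
  have h1 : Integrable (fun y => g (y * Circle.exp s)) μ :=
    Continuous.integrable_of_compactSpace (by fun_prop)
  have h2 : Integrable (fun y => g (y * Circle.exp (-s))) μ :=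
    Continuous.integrable_of_compactSpace (by fun_prop)
  have h3 : Integrable (fun y => 2 * g y) μ :=
    Continuous.integrable_of_compactSpace (by fun_prop)
  have e1 := integral_add ((h1.add h2).sub h3) (integrable_const c)
  have e2 := integral_sub (h1.add h2) h3
  have e3 := integral_add h1 h2
  simp only [Pi.add_apply, Pi.sub_apply] at e1 e2 e3
  rw [e1, e2, e3, integral_mul_right_eq_self, integral_mul_right_eq_self,
    integral_const_mul]
  simp
  ring

theorem integrable_mkWeight_mul_log [IsFiniteMeasure μ] {N : ℕ} {f g : Circle → ℝ}
    (hf : Continuous f)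
    (hg : Continuous g) (hfpos : ∀ z, 0 < f z) (hgpos : ∀ z, 0 < g z) (z : Circle) :
    Integrable (fun w => mkWeight N f z w *
      (Real.log (mkWeight N g z w) - Real.log (mkWeight N f z w))) (Measure.pi fun _ => μ) := by
  have hP := continuous_mkWeight_right (N := N) hf z
  have hQ := continuous_mkWeight_right (N := N) hg z
  exact (hP.mul ((hQ.log fun w => (mkWeight_pos hgpos z w).ne').sub
    (hP.log fun w => (mkWeight_pos hfpos z w).ne'))).integrable_of_compactSpace

theorem integral_mkWeight_mul_log_le [μ.IsHaarMeasure] [IsProbabilityMeasure μ] {N : ℕ}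
    {f g : Circle → ℝ} (hf : Continuous f)
    (hg : Continuous g) (hfpos : ∀ z, 0 < f z) (hgpos : ∀ z, 0 < g z) (z : Circle) :
    ∫ w, mkWeight N f z w * (Real.log (mkWeight N g z w) - Real.log (mkWeight N f z w))
        ∂(Measure.pi fun _ => μ) ≤
      MK μ N f z * (Real.log (MK μ N g z) - Real.log (MK μ N f z)) :=
  integral_mul_log_sub_log_le (mkWeight_pos hfpos z) (mkWeight_pos hgpos z)
    (integrable_mkWeight hf z) (integrable_mkWeight hg z)
    (integrable_mkWeight_mul_log hf hg hfpos hgpos z) (MK_pos hf hfpos z) (MK_pos hg hgpos z)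

theorem MK_mul_pow_le_mkWeight [IsProbabilityMeasure μ] {N : ℕ} {f : Circle → ℝ}
    (hf : Continuous f) {M r : ℝ}
    (hM : 0 < M) (hr : 0 < r) (hle : ∀ z, f z ≤ M) (hge : ∀ z, M * r ≤ f z) (z : Circle)
    (w : Fin (N - 1) → Circle) : MK μ N f z * r ^ (N ^ 2) ≤ mkWeight N f z w := by
  have hpos : ∀ z, 0 < f z := fun z => (mul_pos hM hr).trans_le (hge z)
  have h1 : MK μ N f z ≤ M ^ (N ^ 2) := by
    calc MK μ N f z ≤ ∫ _w, M ^ (N ^ 2) ∂(Measure.pi fun _ : Fin (N - 1) => μ) :=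
          integral_mono (integrable_mkWeight hf z) (integrable_const _) (mkWeight_le hpos hle z)
      _ = M ^ (N ^ 2) := by simp
  calc MK μ N f z * r ^ (N ^ 2) ≤ M ^ (N ^ 2) * r ^ (N ^ 2) := by gcongr
    _ = (M * r) ^ (N ^ 2) := (mul_pow _ _ _).symm
    _ ≤ mkWeight N f z w := le_mkWeight (mul_pos hM hr).le hge z w

theorem LogSemiconvex.migdalKadanoff [μ.IsHaarMeasure] [IsProbabilityMeasure μ] {N : ℕ}
    (hN : 2 ≤ N) {f : Circle → ℝ} (hf : Continuous f)
    {a M r : ℝ} (hM : 0 < M) (hr : 0 < r) (hle : ∀ z, f z ≤ M) (hge : ∀ z, M * r ≤ f z)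
    (h : LogSemiconvex a f) :
    LogSemiconvex (a * (1 - r ^ (N ^ 2) / N)) (MK μ N f) := by
  intro z t
  have hpos : ∀ z, 0 < f z := fun z => (mul_pos hM hr).trans_le (hge z)
  have hN0 : (0 : ℝ) < N := by exact_mod_cast (by omega : 0 < N)
  obtain ⟨s, rfl⟩ : ∃ s, t = N * s := ⟨t / N, by field_simp⟩
  have hshift : ∀ s : ℝ, Continuous fun y => f (y * Circle.exp s) := fun s => by fun_prop
  have hspos : ∀ s : ℝ, ∀ y, 0 < f (y * Circle.exp s) := fun s y => hpos _
  have hneg : -(N * s) = N * (-s) := by ring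
  rw [hneg, MK_mul_exp, MK_mul_exp]
  have hDc := continuous_logSecondDiff hf hpos a s
  let j : Fin (N - 1) := ⟨0, by omega⟩
  have hDj : ∫ w : Fin (N - 1) → Circle, logSecondDiff f a s (w j) ∂(Measure.pi fun _ => μ) =
      a * s ^ 2 := by
    rw [integral_comp_eval (μ := fun _ : Fin (N - 1) => μ) (i := j) hDc.aestronglyMeasurable]
    exact integral_second_difference (hf.log fun y => (hpos y).ne') s _
  have hDi : Integrable (fun w : Fin (N - 1) → Circle => logSecondDiff f a s (w j))
      (Measure.pi fun _ => μ) :=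
    (hDc.comp (continuous_apply j)).integrable_of_compactSpace
  have hPi := integrable_mkWeight (μ := μ) (N := N) hf z
  have hL := fun s =>
    integrable_mkWeight_mul_log (μ := μ) (N := N) hf (hshift s) hpos (hspos s) z
  have gibbs := fun s =>
    integral_mkWeight_mul_log_le (μ := μ) (N := N) hf (hshift s) hpos (hspos s) z
  have hsum := (integral_add (hL s) (hL (-s))).trans_le (add_le_add (gibbs s) (gibbs (-s)))
  have hmono := integral_mono ((hDi.const_mul (MK μ N f z * r ^ (N ^ 2) * N)).sub
    (hPi.mul_const (a * (N * s) ^ 2))) ((hL s).add (hL (-s))) fun w => by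
      have h1 := mul_le_mul_of_nonneg_left (le_log_mkWeight_shift hN hpos h s z w)
        (mkWeight_pos hpos z w).le
      have h2 := mul_le_mul_of_nonneg_right (MK_mul_pow_le_mkWeight (μ := μ) hf hM hr hle hge z w)
        (mul_nonneg hN0.le (h.logSecondDiff_nonneg s (w j)))
      simp only [Pi.add_apply, Pi.sub_apply]
      linarith
  have hlhs := integral_sub (hDi.const_mul (MK μ N f z * r ^ (N ^ 2) * N))
    (hPi.mul_const (a * (N * s) ^ 2))
  rw [integral_const_mul, integral_mul_const, hDj] at hlhs
  have h3 := hlhs.symm.trans_le (hmono.trans hsum)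
  change _ - MK μ N f z * _ ≤ _ at h3
  have h4 : MK μ N f z * (r ^ (N ^ 2) * N * (a * s ^ 2) - a * (N * s) ^ 2) ≤
      MK μ N f z * ((Real.log (MK μ N (fun y => f (y * Circle.exp s)) z) -
        Real.log (MK μ N f z)) + (Real.log (MK μ N (fun y => f (y * Circle.exp (-s))) z) -
        Real.log (MK μ N f z))) := by
    linarith
  have h5 := le_of_mul_le_mul_left h4 (MK_pos hf hpos z)
  have h6 : a * (1 - r ^ (N ^ 2) / N) * (N * s) ^ 2 =
      a * (N * s) ^ 2 - r ^ (N ^ 2) * N * (a * s ^ 2) := by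
    field_simp
  rw [h6]
  linarith

theorem LogSemiconvex.exists_bounds {f : Circle → ℝ} (hf : Continuous f) (hpos : ∀ z, 0 < f z)
    {a : ℝ} (ha : 0 ≤ a) (h : LogSemiconvex a f) :
    ∃ M, 0 < M ∧ (∀ z, f z ≤ M) ∧ ∀ z, M * Real.exp (-(a * Real.pi ^ 2)) ≤ f z := by
  obtain ⟨z₀, -, hz₀⟩ := isCompact_univ.exists_isMaxOn Set.univ_nonempty hf.continuousOn
  have hmax : ∀ z, f z ≤ f z₀ := fun z => hz₀ (Set.mem_univ z)
  refine ⟨f z₀, hpos _, hmax, fun z => ?_⟩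
  set t := Complex.arg ((z₀⁻¹ * z : Circle) : ℂ) with ht
  have hz : z₀ * Circle.exp t = z := by
    rw [ht, Circle.exp_arg, mul_inv_cancel_left]
  have ht2 : t ^ 2 ≤ Real.pi ^ 2 := sq_le_sq' (Complex.neg_pi_lt_arg _).le (Complex.arg_le_pi _)
  have h1 := h z₀ t
  rw [hz] at h1
  have h2 := Real.log_le_log (hpos _) (hmax (z₀ * Circle.exp (-t)))
  have h3 := mul_le_mul_of_nonneg_left ht2 ha
  rw [← Real.log_le_log_iff (mul_pos (hpos _) (Real.exp_pos _)) (hpos _),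
    Real.log_mul (hpos _).ne' (Real.exp_pos _).ne', Real.log_exp]
  linarith

theorem integral_zpow_eq_zero [μ.IsHaarMeasure] {n : ℤ} (hn : n ≠ 0) :
    ∫ z : Circle, ((z ^ n : Circle) : ℂ) ∂μ = 0 := by
  have h := integral_mul_left_eq_self (μ := μ) (fun z : Circle => ((z ^ n : Circle) : ℂ))
    (Circle.exp (Real.pi / n))
  have hw : ((Circle.exp (Real.pi / n) ^ n : Circle) : ℂ) = -1 := by
    have hn' : (n : ℂ) ≠ 0 := by exact_mod_cast hn
    rw [Circle.coe_zpow, Circle.coe_exp, ← Complex.exp_int_mul]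
    push_cast
    rw [← Complex.exp_pi_mul_I]
    congr 1
    field_simp
  simp_rw [mul_zpow, Circle.coe_mul, hw, integral_const_mul] at h
  linear_combination (-1 / 2 : ℂ) * h

theorem norm_fourierCoeff_div_le [μ.IsHaarMeasure] [IsProbabilityMeasure μ] {f : Circle → ℝ}
    (hf : Continuous f) {M δ : ℝ} (hM : 0 < M)
    (hle : ∀ z, f z ≤ M) (hge : ∀ z, M * Real.exp (-δ) ≤ f z) {n : ℤ} (hn : n ≠ 0) :
    ‖(∫ z, (f z : ℂ) * ((z ^ n : Circle) : ℂ) ∂μ) / (∫ z, (f z : ℂ) ∂μ)‖ ≤ Real.exp δ - 1 := by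
  have hfi : Integrable f μ := hf.integrable_of_compactSpace
  have hzc : Continuous fun z : Circle => ((z ^ n : Circle) : ℂ) :=
    continuous_induced_dom.comp (continuous_zpow n)
  have hden : M * Real.exp (-δ) ≤ ∫ z, f z ∂μ := by
    calc M * Real.exp (-δ) = ∫ _z, M * Real.exp (-δ) ∂μ := by simp
      _ ≤ _ := integral_mono (integrable_const _) hfi hge
  have hnum : ‖∫ z, (f z : ℂ) * ((z ^ n : Circle) : ℂ) ∂μ‖ ≤ M - M * Real.exp (-δ) := by
    have hfz : Integrable (fun z : Circle => (f z : ℂ) * ((z ^ n : Circle) : ℂ)) μ :=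
      ((Complex.continuous_ofReal.comp hf).mul hzc).integrable_of_compactSpace
    have hMz : Integrable (fun z : Circle => (M : ℂ) * ((z ^ n : Circle) : ℂ)) μ :=
      (continuous_const.mul hzc).integrable_of_compactSpace
    have heq : ∫ z, (f z : ℂ) * ((z ^ n : Circle) : ℂ) ∂μ =
        ∫ z, ((f z : ℂ) * ((z ^ n : Circle) : ℂ) - (M : ℂ) * ((z ^ n : Circle) : ℂ)) ∂μ := by
      rw [integral_sub hfz hMz, integral_const_mul, integral_zpow_eq_zero hn, mul_zero, sub_zero]
    rw [heq]
    refine (norm_integral_le_of_norm_le_const (C := M - M * Real.exp (-δ))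
      (Eventually.of_forall fun z => ?_)).trans (by simp)
    rw [← sub_mul, norm_mul, Circle.norm_coe, mul_one, ← Complex.ofReal_sub, Complex.norm_real,
      Real.norm_eq_abs, abs_of_nonpos (sub_nonpos.2 (hle z))]
    linarith [hge z]
  have hpos : 0 < M * Real.exp (-δ) := by positivity
  rw [norm_div, integral_complex_ofReal, Complex.norm_real, Real.norm_eq_abs,
    abs_of_pos (hpos.trans_le hden)]
  calc _ ≤ (M - M * Real.exp (-δ)) / (M * Real.exp (-δ)) :=
        div_le_div₀ ((norm_nonneg _).trans hnum) hnum hpos hden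
    _ = Real.exp δ - 1 := by
        rw [Real.exp_neg]
        field_simp

end Transformation

theorem logSemiconvex_exp_mul_re {β : ℝ} (hβ : 0 ≤ β) :
    LogSemiconvex β fun z : Circle => Real.exp (β * (z : ℂ).re) := by
  intro z t
  simp only [Real.log_exp, Circle.coe_mul, Circle.coe_exp, Complex.mul_re,
    Complex.exp_ofReal_mul_I_re, Complex.exp_ofReal_mul_I_im, Real.cos_neg, Real.sin_neg]
  have h1 : (z : ℂ).re ≤ 1 := (Complex.re_le_norm _).trans_eq (Circle.norm_coe z)
  have h2 := Real.one_sub_sq_div_two_le_cos (x := t)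
  have h3 := Real.cos_le_one t
  have h4 : 0 ≤ (1 - (z : ℂ).re) * (1 - Real.cos t) :=
    mul_nonneg (sub_nonneg.2 h1) (sub_nonneg.2 h3)
  have h5 : 0 ≤ β * (t ^ 2 - 2 * ((z : ℂ).re * (1 - Real.cos t))) :=
    mul_nonneg hβ (by linarith)
  linarith

/-- For `β > 0`, `b ≥ 2`, `N = b²`, starting from `f₀(z) = exp(β·Re z)` on the
circle group `𝕋 = U(1)` and iterating the Migdal–Kadanoff transformation, all normalized
Fourier coefficients `c_n(k)` with `n ≠ 0` tend to `0` as `k → ∞`. -/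
theorem statement1
    (μ : Measure Circle) [μ.IsHaarMeasure] [IsProbabilityMeasure μ]
    (β : ℝ) (hβ : 0 < β) (b : ℕ) (hb : 2 ≤ b)
    (f : ℕ → Circle → ℝ)
    (hf0 : ∀ z : Circle, f 0 z = Real.exp (β * (z : ℂ).re))
    (hfsucc : ∀ k : ℕ, f (k + 1) = MK μ (b ^ 2) (f k))
    (c : ℤ → ℕ → ℂ)
    (hc : ∀ (n : ℤ) (k : ℕ),
      c n k = (∫ z, (f k z : ℂ) * ((z ^ (-n) : Circle) : ℂ) ∂μ) / (∫ z, (f k z : ℂ) ∂μ)) :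
    ∀ n : ℤ, n ≠ 0 → Tendsto (fun k => c n k) atTop (nhds 0) := by
  have hN : 2 ≤ b ^ 2 := by nlinarith
  set ε := Real.exp (-(β * Real.pi ^ 2)) ^ ((b ^ 2) ^ 2) / ((b ^ 2 : ℕ) : ℝ)
  have hN1 : (1 : ℝ) ≤ ((b ^ 2 : ℕ) : ℝ) := by exact_mod_cast (by omega : 1 ≤ b ^ 2)
  have hε0 : 0 < ε := by positivity
  have hε1 : ε ≤ 1 := by
    refine div_le_one_of_le₀ (le_trans ?_ hN1) (by positivity)
    refine pow_le_one₀ (Real.exp_pos _).le (Real.exp_le_one_iff.2 ?_)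
    exact neg_nonpos.2 (by positivity)
  have hr : ∀ k : ℕ, 0 ≤ β * (1 - ε) ^ k := fun k =>
    mul_nonneg hβ.le (pow_nonneg (by linarith) k)
  have main : ∀ k, Continuous (f k) ∧ (∀ z, 0 < f k z) ∧ LogSemiconvex (β * (1 - ε) ^ k) (f k) := by
    intro k
    induction k with
    | zero =>
      have : f 0 = fun z : Circle => Real.exp (β * (z : ℂ).re) := funext hf0
      rw [this, pow_zero, mul_one]
      refine ⟨?_, fun z => Real.exp_pos _, logSemiconvex_exp_mul_re hβ.le⟩
      exact Real.continuous_exp.comp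
        (continuous_const.mul (Complex.continuous_re.comp continuous_induced_dom))
    | succ k ih =>
      obtain ⟨hcont, hpos, hlsc⟩ := ih
      rw [hfsucc k, pow_succ (1 - ε), ← mul_assoc]
      refine ⟨continuous_MK hcont, MK_pos hcont hpos, ?_⟩
      obtain ⟨M, hM, hle, hge⟩ := hlsc.exists_bounds hcont hpos (hr k)
      refine LogSemiconvex.migdalKadanoff hN hcont hM (Real.exp_pos _) hle
        (fun z => le_trans ?_ (hge z)) hlsc
      have : (1 - ε) ^ k ≤ 1 := pow_le_one₀ (by linarith) (by linarith)
      have : β * (1 - ε) ^ k ≤ β := mul_le_of_le_one_right hβ.le this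
      gcongr
  intro n hn
  have hlim : Tendsto (fun k : ℕ => Real.exp (β * (1 - ε) ^ k * Real.pi ^ 2) - 1) atTop
      (nhds 0) := by
    have h1 := tendsto_pow_atTop_nhds_zero_of_lt_one (r := 1 - ε) (by linarith) (by linarith)
    have h2 := (Real.continuous_exp.tendsto _).comp ((h1.const_mul β).mul_const (Real.pi ^ 2))
    simpa using h2.sub_const 1
  refine squeeze_zero_norm (fun k => ?_) hlim
  obtain ⟨hcont, hpos, hlsc⟩ := main k
  obtain ⟨M, hM, hle, hge⟩ := hlsc.exists_bounds hcont hpos (hr k)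
  rw [hc]
  exact norm_fourierCoeff_div_le hcont hM hle hge (neg_ne_zero.2 hn)
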